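/- arXiv:2109.01701 — 3 statements merged into one kernel-verified Lean document; each statement's English description precedes it below -/
import Mathlib

section
/- Let H : ℝ → C(Z) be a single-parameter hierarchical clustering of a set Z that is closed below. Then for every (s,S) ∈ Γ(H) there exists a layer point (t,S) ∈ Λ(H) with t ≤ s, and every layer point (r,R) ∈ Λ(H) with (r,R) ≤ (s,S) satisfies (r,R) ≤ (t,S). In particular, every element of Γ(H) has a unique maximal layer point below it, and this layer point has the same cluster. -/
/-- The partial order on `R^v`: coordinate `i` uses the usual order on `ℝ`
if `v i = true` (i.e. `v_i = 1`) and the opposite order if `v i = false` (i.e. `v_i = -1`). -/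
def vle {n : ℕ} (v : Fin n → Bool) (s t : Fin n → ℝ) : Prop :=
  ∀ i, if v i then s i ≤ t i else t i ≤ s i

/-- A clustering of `Z`: a set of pairwise disjoint nonempty subsets of `Z`. -/
def IsClustering {Z : Type*} (A : Set (Set Z)) : Prop :=
  (∀ S ∈ A, S.Nonempty) ∧ (∀ S ∈ A, ∀ T ∈ A, S ≠ T → Disjoint S T)

/-- The partial order on clusterings: `A ≤ B` iff every cluster of `A` is contained
in some cluster of `B`. -/
def ClusterLE {Z : Type*} (A B : Set (Set Z)) : Prop :=
  ∀ S ∈ A, ∃ T ∈ B, S ⊆ T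

/-- A `v`-hierarchical clustering of `Z`: an order-preserving map `R^v → C(Z)`
which is empty somewhere. -/
def IsHC {Z : Type*} {n : ℕ} (v : Fin n → Bool) (H : (Fin n → ℝ) → Set (Set Z)) : Prop :=
  (∀ s, IsClustering (H s)) ∧ (∀ s t, vle v s t → ClusterLE (H s) (H t)) ∧ (∃ s, H s = ∅)

/-- The generating relation for the layer equivalence on `Γ(H)`:
`(s,S) ∼ (t,S)` whenever `s ≤ t` and `S ∈ H s ∩ H t`. -/
def layerRel {Z : Type*} {n : ℕ} (v : Fin n → Bool) (H : (Fin n → ℝ) → Set (Set Z)) :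
    (Fin n → ℝ) × Set Z → (Fin n → ℝ) × Set Z → Prop :=
  fun a b => a.2 = b.2 ∧ vle v a.1 b.1 ∧ a.2 ∈ H a.1 ∧ a.2 ∈ H b.1

/-- Two elements of `Γ(H)` lie in the same layer. -/
def SameLayer {Z : Type*} {n : ℕ} (v : Fin n → Bool) (H : (Fin n → ℝ) → Set (Set Z))
    (a b : (Fin n → ℝ) × Set Z) : Prop :=
  Relation.EqvGen (layerRel v H) a b

/-- The support of the layer of `(s, S)` in `Γ(H)`. -/
def layerSupp {Z : Type*} {n : ℕ} (v : Fin n → Bool) (H : (Fin n → ℝ) → Set (Set Z))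
    (s : Fin n → ℝ) (S : Set Z) : Set (Fin n → ℝ) :=
  {p | S ∈ H p ∧ SameLayer v H (p, S) (s, S)}

/-- The up-set `U_P` of `P ⊆ R^v`. -/
def upSet {n : ℕ} (v : Fin n → Bool) (P : Set (Fin n → ℝ)) : Set (Fin n → ℝ) :=
  {r | ∃ p ∈ P, vle v p r}

/-- The down-set `D_P` of `P ⊆ R^v`. -/
def downSet {n : ℕ} (v : Fin n → Bool) (P : Set (Fin n → ℝ)) : Set (Fin n → ℝ) :=
  {r | ∃ p ∈ P, vle v r p}

/-- `(s, S)` is a global layer point of `Γ(H)`: every `(t,T) ∈ Γ(H)` with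
`(t,T) < (s,S)` satisfies `T ≠ S`. -/
def GlobalLayerPoint {Z : Type*} {n : ℕ} (v : Fin n → Bool)
    (H : (Fin n → ℝ) → Set (Set Z)) (s : Fin n → ℝ) (S : Set Z) : Prop :=
  S ∈ H s ∧ ∀ t T, T ∈ H t → vle v t s → T ⊆ S → (t, T) ≠ (s, S) → T ≠ S

/-- `(s, S)` is an `i`-th parameter layer point of `Γ(H)`. -/
def IthLayerPoint {Z : Type*} {n : ℕ} (v : Fin n → Bool)
    (H : (Fin n → ℝ) → Set (Set Z)) (i : Fin n) (s : Fin n → ℝ) (S : Set Z) : Prop :=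
  S ∈ H s ∧ ∀ t : ℝ, (if v i then t < s i else s i < t) →
    ∀ T ∈ H (Function.update s i t), T ⊆ S → T ≠ S
/-- A single-parameter hierarchical clustering of `Z`. -/
def IsHC1 {Z : Type*} (H : ℝ → Set (Set Z)) : Prop :=
  (∀ s, IsClustering (H s)) ∧ (∀ s t : ℝ, s ≤ t → ClusterLE (H s) (H t)) ∧ (∃ s, H s = ∅)

/-- Generating relation for the layer equivalence, single-parameter case. -/
def layerRel1 {Z : Type*} (H : ℝ → Set (Set Z)) : ℝ × Set Z → ℝ × Set Z → Prop :=
  fun a b => a.2 = b.2 ∧ a.1 ≤ b.1 ∧ a.2 ∈ H a.1 ∧ a.2 ∈ H b.1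

/-- The support of the layer of `(s, S)`, single-parameter case. -/
def layerSupp1 {Z : Type*} (H : ℝ → Set (Set Z)) (s : ℝ) (S : Set Z) : Set ℝ :=
  {p | S ∈ H p ∧ Relation.EqvGen (layerRel1 H) (p, S) (s, S)}

/-- `H` is closed below: the infimum of the support of every layer belongs to the support. -/
def ClosedBelow1 {Z : Type*} (H : ℝ → Set (Set Z)) : Prop :=
  ∀ s S, S ∈ H s → sInf (layerSupp1 H s S) ∈ layerSupp1 H s S

/-- `(s, S)` is a layer point of `Γ(H)`, single-parameter case. -/
def LayerPoint1 {Z : Type*} (H : ℝ → Set (Set Z)) (s : ℝ) (S : Set Z) : Prop :=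
  S ∈ H s ∧ ∀ t T, T ∈ H t → t ≤ s → T ⊆ S → (t, T) ≠ (s, S) → T ≠ S

theorem mem_layerSupp1 {Z : Type*} {H : ℝ → Set (Set Z)} {s p : ℝ} {S : Set Z}
    (hs : S ∈ H s) (hp : S ∈ H p) : p ∈ layerSupp1 H s S := by
  refine ⟨hp, ?_⟩
  rcases le_total p s with h | h
  · exact .rel _ _ ⟨rfl, h, hp, hs⟩
  · exact .symm _ _ (.rel _ _ ⟨rfl, h, hs, hp⟩)

theorem IsClustering.eq_of_subset {Z : Type*} {A : Set (Set Z)} (hA : IsClustering A)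
    {S T : Set Z} (hS : S ∈ A) (hT : T ∈ A) (h : S ⊆ T) : S = T := by
  by_contra hne
  obtain ⟨x, hx⟩ := hA.1 S hS
  exact Set.disjoint_left.1 (hA.2 S hS T hT hne) hx (h hx)

theorem IsHC1.bddBelow_layerSupp1 {Z : Type*} {H : ℝ → Set (Set Z)} (hH : IsHC1 H)
    (s : ℝ) (S : Set Z) : BddBelow (layerSupp1 H s S) := by
  obtain ⟨a, ha⟩ := hH.2.2
  refine ⟨a, fun p hp => ?_⟩
  by_contra! hlt
  obtain ⟨T, hT, -⟩ := hH.2.1 p a hlt.le S hp.1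
  simp [ha] at hT

/-- A cluster present at two parameters is present at every parameter in between. -/
theorem IsHC1.mem_of_le_of_le {Z : Type*} {H : ℝ → Set (Set Z)} (hH : IsHC1 H)
    {t r s : ℝ} {S : Set Z} (htr : t ≤ r) (hrs : r ≤ s) (ht : S ∈ H t) (hs : S ∈ H s) :
    S ∈ H r := by
  obtain ⟨T, hT, hST⟩ := hH.2.1 t r htr S ht
  obtain ⟨S', hS', hTS'⟩ := hH.2.1 r s hrs T hT
  have hSS' : S = S' := (hH.1 s).eq_of_subset hs hS' (hST.trans hTS')
  have hTS : T ⊆ S := hSS' ▸ hTS'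
  rwa [hST.antisymm hTS]

/-- For a single-parameter hierarchical clustering that is closed below,
every `(s,S) ∈ Γ(H)` has a layer point `(t,S)` below it which dominates every layer
point `(r,R) ≤ (s,S)`; in particular every element of `Γ(H)` has a unique maximal
layer point below it, with the same cluster. -/
theorem statement7 {Z : Type*} (H : ℝ → Set (Set Z))
    (hH : IsHC1 H) (hcb : ClosedBelow1 H)
    (s : ℝ) (S : Set Z) (hS : S ∈ H s) :
    ∃ t : ℝ, t ≤ s ∧ LayerPoint1 H t S ∧
      ∀ r R, LayerPoint1 H r R → r ≤ s → R ⊆ S → r ≤ t ∧ R ⊆ S := by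
  have hbdd := hH.bddBelow_layerSupp1 s S
  have ht : S ∈ H (sInf (layerSupp1 H s S)) := (hcb s S hS).1
  have hts : sInf (layerSupp1 H s S) ≤ s := csInf_le hbdd (mem_layerSupp1 hS hS)
  refine ⟨sInf (layerSupp1 H s S), hts, ⟨ht, ?_⟩, ?_⟩
  · rintro u T hT hu - hne rfl
    exact hne (by rw [hu.antisymm (csInf_le hbdd (mem_layerSupp1 hS hT))])
  · intro r R hR hrs hRS
    refine ⟨?_, hRS⟩
    by_contra! hlt
    have hSr : S ∈ H r := hH.mem_of_le_of_le hlt.le hrs ht hS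
    obtain rfl : R = S := (hH.1 r).eq_of_subset hR.1 hSr hRS
    exact hR.2 _ R ht hlt.le subset_rfl (fun h => hlt.ne (congrArg Prod.fst h)) rfl
end

section
/- Let X ⊆ Y be finite metric spaces with |Y| ≥ k+1 for some k ∈ ℕ, let c, ε, δ ≥ 0 satisfy N_k(X,Y) − ε ≤ c ≤ δ and δ ≥ 2·h(Y,X), and let θ : Y → X satisfy d(y, θ(y)) ≤ h(Y,X) for all y ∈ Y and θ(x) = x for all x ∈ X. Then for every s ≥ c: (i) every connected component S of V_s(X) is contained in a unique connected component i_ε(S) of L_{s+ε,k}(Y); (ii) for every connected component T of L_{s,k}(Y), θ(T) is contained in a unique connected component θ_δ(T) of V_{s+δ}(X); (iii) for every connected component S of V_s(X), the connected component of V_{s+ε+δ}(X) containing θ_δ(i_ε(S)) equals the connected component of V_{s+ε+δ}(X) containing S; (iv) for every connected component T of L_{s,k}(Y), the connected component of L_{s+ε+δ,k}(Y) containing i_ε(θ_δ(T)) equals the connected component of L_{s+ε+δ,k}(Y) containing T. That is, (X, L₀X[c]) is an (ε,δ)-approximation of (Y, L_kY). -/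
open Metric in
/-- The edge relation at scale `s` of the graph with vertex set `V`
(inside an ambient metric space): an edge between distinct vertices at distance `≤ s`. -/
def adjRel {Y : Type*} [MetricSpace Y] (V : Set Y) (s : ℝ) (a b : Y) : Prop :=
  a ∈ V ∧ b ∈ V ∧ a ≠ b ∧ dist a b ≤ s

/-- Reachability (a path of edges) in the graph with vertex set `V` and edges
between distinct vertices at distance `≤ s`. -/
def Reach {Y : Type*} [MetricSpace Y] (V : Set Y) (s : ℝ) (a b : Y) : Prop :=
  Relation.ReflTransGen (adjRel V s) a b

/-- `S` is (the vertex set of) a connected component of the graph with vertex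
set `V` and edges between distinct vertices at distance `≤ s`.
For `V = X` this graph is the Vietoris–Rips graph `V_s(X)`. -/
def IsCC {Y : Type*} [MetricSpace Y] (V : Set Y) (s : ℝ) (S : Set Y) : Prop :=
  ∃ a ∈ V, S = {b | Reach V s a b}

/-- The vertex set of the Lesnick graph `L_{s,k}(Y)`: the points of `Y` having at
least `k` distinct `s`-neighbours in `Y`. -/
def lesnickVerts (Y : Type*) [MetricSpace Y] (k : ℕ) (s : ℝ) : Set Y :=
  {y | k ≤ Set.ncard {y' : Y | y' ≠ y ∧ dist y y' ≤ s}}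

/-- The directional Hausdorff distance `h(Y, X) = max_{y ∈ Y} min_{x ∈ X} d(y, x)`. -/
noncomputable def dirHaus {Y : Type*} [MetricSpace Y] (X : Set Y) : ℝ :=
  ⨆ y : Y, ⨅ x : X, dist y (x : Y)

/-- `N_k(X, Y) = max_{x ∈ X} min_S max_{y ∈ S} d(x, y)`, the minimum over all
`(k+1)`-element subsets `S ⊆ Y`. -/
noncomputable def Nk {Y : Type*} [MetricSpace Y] (k : ℕ) (X : Set Y) : ℝ :=
  ⨆ x : X, ⨅ S : {S : Finset Y // S.card = k + 1}, ⨆ y : (S : Finset Y), dist (x : Y) (y : Y)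

theorem adjRel.symm {Y : Type*} [MetricSpace Y] {V : Set Y} {s : ℝ} {a b : Y}
    (h : adjRel V s a b) : adjRel V s b a :=
  ⟨h.2.1, h.1, h.2.2.1.symm, dist_comm a b ▸ h.2.2.2⟩

theorem Reach.symm {Y : Type*} [MetricSpace Y] {V : Set Y} {s : ℝ} {a b : Y}
    (h : Reach V s a b) : Reach V s b a :=
  have : Std.Symm (adjRel V s) := ⟨fun _ _ => adjRel.symm⟩
  Relation.ReflTransGen.stdSymm.symm _ _ h

theorem reach_of_dist_le {Y : Type*} [MetricSpace Y] {V : Set Y} {s : ℝ} {a b : Y}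
    (ha : a ∈ V) (hb : b ∈ V) (h : dist a b ≤ s) : Reach V s a b := by
  by_cases hab : a = b
  · exact hab ▸ Relation.ReflTransGen.refl
  · exact Relation.ReflTransGen.single ⟨ha, hb, hab, h⟩

/-- A map moving vertices to vertices and adjacent points within the new scale preserves
reachability. -/
theorem Reach.map {Y : Type*} [MetricSpace Y] {V W : Set Y} {s t : ℝ} (f : Y → Y)
    (hf : ∀ y ∈ V, f y ∈ W) (hd : ∀ y z, dist y z ≤ s → dist (f y) (f z) ≤ t) {a b : Y}
    (h : Reach V s a b) : Reach W t (f a) (f b) := by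
  induction h with
  | refl => exact Relation.ReflTransGen.refl
  | tail _ hbc ih =>
    exact ih.trans (reach_of_dist_le (hf _ hbc.1) (hf _ hbc.2.1) (hd _ _ hbc.2.2.2))

theorem Reach.mem {Y : Type*} [MetricSpace Y] {V : Set Y} {s : ℝ} {a b : Y}
    (h : Reach V s a b) (ha : a ∈ V) : b ∈ V := by
  induction h with
  | refl => exact ha
  | tail _ hbc _ => exact hbc.2.1

theorem IsCC.subset {Y : Type*} [MetricSpace Y] {V : Set Y} {s : ℝ} {S : Set Y}
    (hS : IsCC V s S) : S ⊆ V := by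
  obtain ⟨a, ha, rfl⟩ := hS
  exact fun b hb => Reach.mem hb ha

theorem IsCC.eq_setOf_reach {Y : Type*} [MetricSpace Y] {V : Set Y} {s : ℝ} {S : Set Y}
    (hS : IsCC V s S) {b : Y} (hb : b ∈ S) : S = {z | Reach V s b z} := by
  obtain ⟨a, -, rfl⟩ := hS
  exact Set.ext fun z => ⟨fun hz => (Reach.symm hb).trans hz,
    fun hz => Relation.ReflTransGen.trans hb hz⟩

/-- The image of a component under a map as in `Reach.map` lies in a unique component. -/
theorem IsCC.existsUnique_image_subset {Y : Type*} [MetricSpace Y] {V W : Set Y} {s t : ℝ}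
    (f : Y → Y) (hf : ∀ y ∈ V, f y ∈ W) (hd : ∀ y z, dist y z ≤ s → dist (f y) (f z) ≤ t)
    {S : Set Y} (hS : IsCC V s S) : ∃! T : Set Y, IsCC W t T ∧ f '' S ⊆ T := by
  obtain ⟨a, ha, rfl⟩ := hS
  refine ⟨{z | Reach W t (f a) z}, ⟨⟨f a, hf a ha, rfl⟩, ?_⟩, ?_⟩
  · rintro _ ⟨b, hb, rfl⟩
    exact Reach.map f hf hd hb
  · rintro T ⟨hT, hsub⟩
    exact hT.eq_setOf_reach (hsub ⟨a, Relation.ReflTransGen.refl, rfl⟩)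

theorem lesnickVerts_mono {Y : Type*} [MetricSpace Y] [Finite Y] (k : ℕ) {s t : ℝ}
    (hst : s ≤ t) : lesnickVerts Y k s ⊆ lesnickVerts Y k t := fun _ hy =>
  hy.out.trans (Set.ncard_le_ncard (fun _ hz => And.imp_right (le_trans · hst) hz)
    (Set.toFinite _))

theorem subset_lesnickVerts_of_Nk_le {Y : Type*} [MetricSpace Y] [Fintype Y] {k : ℕ}
    {X : Set Y} (hcard : k + 1 ≤ Fintype.card Y) {s : ℝ} (hs : Nk k X ≤ s) :
    X ⊆ lesnickVerts Y k s := by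
  classical
  intro x hx
  obtain ⟨S₀, -, hS₀⟩ := Finset.exists_subset_card_eq (s := (Finset.univ : Finset Y)) hcard
  have : Nonempty {S : Finset Y // S.card = k + 1} := ⟨⟨S₀, hS₀⟩⟩
  obtain ⟨S, hS⟩ := exists_eq_ciInf_of_finite
    (f := fun S : {S : Finset Y // S.card = k + 1} => ⨆ y : (S : Finset Y), dist x (y : Y))
  have hle : ⨆ y : (S : Finset Y), dist x (y : Y) ≤ s := by
    refine hS.le.trans (le_trans ?_ hs)
    exact le_ciSup (f := fun x : X => ⨅ S : {S : Finset Y // S.card = k + 1},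
      ⨆ y : (S : Finset Y), dist (x : Y) (y : Y)) (Set.finite_range _).bddAbove ⟨x, hx⟩
  have hdist : ∀ y ∈ (S : Finset Y), dist x y ≤ s := fun y hy =>
    (le_ciSup (f := fun y : (S : Finset Y) => dist x (y : Y))
      (Set.finite_range _).bddAbove ⟨y, hy⟩).trans hle
  have hsub : ((S.1.erase x : Finset Y) : Set Y) ⊆ {y | y ≠ x ∧ dist x y ≤ s} := fun y hy =>
    ⟨Finset.ne_of_mem_erase hy, hdist y (Finset.mem_of_mem_erase hy)⟩
  have hk : k ≤ (S.1.erase x).card := by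
    have := Finset.pred_card_le_card_erase (s := S.1) (a := x)
    have := S.2
    omega
  calc k ≤ (S.1.erase x).card := hk
    _ = ((S.1.erase x : Finset Y) : Set Y).ncard := (Set.ncard_coe_finset _).symm
    _ ≤ _ := Set.ncard_le_ncard hsub (Set.toFinite _)

/-- `(X, L₀X[c])` is an `(ε,δ)`-approximation of `(Y, L_kY)`:
for every `s ≥ c`, (i) each component `S` of `V_s(X)` lies in a unique component
`i_ε(S)` of `L_{s+ε,k}(Y)`; (ii) for each component `T` of `L_{s,k}(Y)`, `θ(T)` lies
in a unique component `θ_δ(T)` of `V_{s+δ}(X)`; (iii) the component of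
`V_{s+ε+δ}(X)` containing `θ_δ(i_ε(S))` is the one containing `S`; (iv) the
component of `L_{s+ε+δ,k}(Y)` containing `i_ε(θ_δ(T))` is the one containing `T`. -/
theorem statement11 {Y : Type*} [MetricSpace Y] [Fintype Y] (k : ℕ) (X : Set Y)
    (hcard : k + 1 ≤ Fintype.card Y)
    (c ε δ : ℝ) (hc : 0 ≤ c) (hε : 0 ≤ ε) (hδ : 0 ≤ δ)
    (hNc : Nk k X - ε ≤ c) (hcδ : c ≤ δ) (hhδ : 2 * dirHaus X ≤ δ)
    (θ : Y → Y) (hθX : ∀ y, θ y ∈ X) (hθ : ∀ y, dist y (θ y) ≤ dirHaus X)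
    (hθfix : ∀ x ∈ X, θ x = x)
    (s : ℝ) (hsc : c ≤ s) :
    (∀ S : Set Y, IsCC X s S →
      ∃! T : Set Y, IsCC (lesnickVerts Y k (s + ε)) (s + ε) T ∧ S ⊆ T) ∧
    (∀ T : Set Y, IsCC (lesnickVerts Y k s) s T →
      ∃! S : Set Y, IsCC X (s + δ) S ∧ θ '' T ⊆ S) ∧
    (∀ S T S' : Set Y, IsCC X s S →
      IsCC (lesnickVerts Y k (s + ε)) (s + ε) T → S ⊆ T →
      IsCC X (s + ε + δ) S' → θ '' T ⊆ S' → S ⊆ S') ∧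
    (∀ T S T' : Set Y, IsCC (lesnickVerts Y k s) s T →
      IsCC X (s + δ) S → θ '' T ⊆ S →
      IsCC (lesnickVerts Y k (s + ε + δ)) (s + ε + δ) T' → S ⊆ T' → T ⊆ T') := by
  have hX : X ⊆ lesnickVerts Y k (s + ε) := subset_lesnickVerts_of_Nk_le hcard (by linarith)
  refine ⟨fun S hS => ?_, fun T hT => ?_, fun S T S' hS _ hST _ hTS' x hx => ?_,
    fun T S T' hT _ hTS hT' hST' y hy => ?_⟩
  · simpa using hS.existsUnique_image_subset id hX
      (fun y z hyz => show dist y z ≤ s + ε by linarith)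
  · refine hT.existsUnique_image_subset θ (fun y _ => hθX y) fun y z hyz => ?_
    have := dist_triangle4 (θ y) y z (θ z)
    linarith [hθ y, hθ z, dist_comm y (θ y)]
  · exact hTS' ⟨x, hST hx, hθfix x (hS.subset hx)⟩
  · rw [hT'.eq_setOf_reach (hST' (hTS ⟨y, hy, rfl⟩))]
    refine reach_of_dist_le (lesnickVerts_mono k (by linarith) (hX (hθX y)))
      (lesnickVerts_mono k (by linarith) (hT.subset hy)) ?_
    rw [dist_comm]
    linarith [hθ y, dist_nonneg (x := y) (y := θ y)]
end

section
/- Let X be a finite metric space with |X| ≥ k+1 for some k ∈ ℕ, and let c, ε, δ ≥ 0 satisfy N_k(X,X) − ε ≤ c ≤ δ. Then (X, L₀X[c]) is an (ε,δ)-approximation of (X, L_kX): for every s ≥ c, (i) every connected component S of V_s(X) is contained in a unique connected component i_ε(S) of L_{s+ε,k}(X); (ii) every connected component T of L_{s,k}(X) is contained in a unique connected component θ_δ(T) of V_{s+δ}(X); (iii) for every connected component S of V_s(X), the connected component of V_{s+ε+δ}(X) containing θ_δ(i_ε(S)) equals the connected component of V_{s+ε+δ}(X) containing S; (iv) for every connected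 component T of L_{s,k}(X), the connected component of L_{s+ε+δ,k}(X) containing i_ε(θ_δ(T)) equals the connected component of L_{s+ε+δ,k}(X) containing T. -/
/-- The edge relation is symmetric. -/
theorem adjRel_symm {Y : Type*} [MetricSpace Y] {V : Set Y} {s : ℝ} :
    Std.Symm (adjRel V s) :=
  ⟨fun a b h => ⟨h.2.1, h.1, h.2.2.1.symm, (dist_comm b a).trans_le h.2.2.2⟩⟩

/-- Reachability is monotone in the vertex set and in the scale. -/
theorem Reach.mono {Y : Type*} [MetricSpace Y] {V W : Set Y} {s t : ℝ} {a b : Y}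
    (hVW : V ⊆ W) (hst : s ≤ t) (h : Reach V s a b) : Reach W t a b :=
  Relation.ReflTransGen.mono (r := adjRel V s) (p := adjRel W t)
    (fun _ _ h => ⟨hVW h.1, hVW h.2.1, h.2.2.1, h.2.2.2.trans hst⟩) a b h

/-- A connected component is the set of points reachable from any of its members. -/
theorem IsCC.eq_of_mem {Y : Type*} [MetricSpace Y] {V : Set Y} {s : ℝ} {S : Set Y} {a : Y}
    (hS : IsCC V s S) (ha : a ∈ S) : S = {b | Reach V s a b} := by
  obtain ⟨r, -, rfl⟩ := hS
  ext b
  exact ⟨fun hb => (Reach.symm ha).trans hb, fun hb => Relation.ReflTransGen.trans ha hb⟩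

/-- Enlarging the vertex set and the scale, every connected component lies in a unique
connected component of the larger graph. -/
theorem IsCC.existsUnique_superset {Y : Type*} [MetricSpace Y] {V W : Set Y} {s t : ℝ}
    {S : Set Y} (hVW : V ⊆ W) (hst : s ≤ t) (hS : IsCC V s S) :
    ∃! T : Set Y, IsCC W t T ∧ S ⊆ T := by
  obtain ⟨a, ha, rfl⟩ := hS
  exact ⟨{b | Reach W t a b}, ⟨⟨a, hVW ha, rfl⟩, fun _ hb => Reach.mono hVW hst hb⟩,
    fun _ hT => hT.1.eq_of_mem (hT.2 Relation.ReflTransGen.refl)⟩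

/-- At scales at least `N_k(X, X)` every point is a vertex of the Lesnick graph. -/
theorem lesnickVerts_eq_univ {X : Type*} [MetricSpace X] [Fintype X] {k : ℕ} {s : ℝ}
    (hcard : k + 1 ≤ Fintype.card X) (hs : Nk k (Set.univ : Set X) ≤ s) :
    lesnickVerts X k s = Set.univ := by
  classical
  refine Set.eq_univ_of_forall fun x => ?_
  obtain ⟨S₀, -, hS₀⟩ := Finset.exists_subset_card_eq (s := (Finset.univ : Finset X)) hcard
  have : Nonempty {S : Finset X // S.card = k + 1} := ⟨⟨S₀, hS₀⟩⟩
  obtain ⟨⟨S, hS⟩, hmin⟩ := exists_eq_ciInf_of_finite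
    (f := fun S : {S : Finset X // S.card = k + 1} => ⨆ y : (S : Finset X), dist x (y : X))
  have hx : (⨆ y : S, dist x (y : X)) ≤ s := by
    refine le_trans ?_ hs
    refine hmin.trans_le ?_
    exact le_ciSup (f := fun x : (Set.univ : Set X) =>
      ⨅ S : {S : Finset X // S.card = k + 1}, ⨆ y : (S : Finset X), dist (x : X) (y : X))
      (Set.finite_range _).bddAbove ⟨x, Set.mem_univ x⟩
  have hsub : (↑(S.erase x) : Set X) ⊆ {y | y ≠ x ∧ dist x y ≤ s} := fun y hy => by
    obtain ⟨hne, hyS⟩ := Finset.mem_erase.mp hy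
    exact ⟨hne, (le_ciSup (f := fun y : S => dist x (y : X))
      (Set.finite_range _).bddAbove ⟨y, hyS⟩).trans hx⟩
  calc k = S.card - 1 := by omega
    _ ≤ (S.erase x).card := Finset.pred_card_le_card_erase
    _ = (↑(S.erase x) : Set X).ncard := (Set.ncard_coe_finset _).symm
    _ ≤ _ := Set.ncard_le_ncard hsub (Set.toFinite _)

/-- `(X, L₀X[c])` is an `(ε,δ)`-approximation of `(X, L_kX)` whenever
`N_k(X,X) − ε ≤ c ≤ δ`. -/
theorem statement18 {X : Type*} [MetricSpace X] [Fintype X] (k : ℕ)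
    (hcard : k + 1 ≤ Fintype.card X)
    (c ε δ : ℝ) (hc : 0 ≤ c) (hε : 0 ≤ ε) (hδ : 0 ≤ δ)
    (hNc : Nk k (Set.univ : Set X) - ε ≤ c) (hcδ : c ≤ δ)
    (s : ℝ) (hsc : c ≤ s) :
    (∀ S : Set X, IsCC (Set.univ : Set X) s S →
      ∃! T : Set X, IsCC (lesnickVerts X k (s + ε)) (s + ε) T ∧ S ⊆ T) ∧
    (∀ T : Set X, IsCC (lesnickVerts X k s) s T →
      ∃! S : Set X, IsCC (Set.univ : Set X) (s + δ) S ∧ T ⊆ S) ∧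
    (∀ S T S' : Set X, IsCC (Set.univ : Set X) s S →
      IsCC (lesnickVerts X k (s + ε)) (s + ε) T → S ⊆ T →
      IsCC (Set.univ : Set X) (s + ε + δ) S' → T ⊆ S' → S ⊆ S') ∧
    (∀ T S T' : Set X, IsCC (lesnickVerts X k s) s T →
      IsCC (Set.univ : Set X) (s + δ) S → T ⊆ S →
      IsCC (lesnickVerts X k (s + ε + δ)) (s + ε + δ) T' → S ⊆ T' → T ⊆ T') := by
  refine ⟨fun S hS => ?_, fun T hT => ?_, fun S T S' _ _ h _ h' => h.trans h',
    fun T S T' _ _ h _ h' => h.trans h'⟩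
  · have hV := lesnickVerts_eq_univ (s := s + ε) hcard (by linarith)
    exact hS.existsUnique_superset hV.ge (by linarith)
  · exact hT.existsUnique_superset (Set.subset_univ _) (by linarith)
end
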